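/- Let N ≥ 2, let G be a connected simple graph on the vertex set Fin N. On a probability space (Ω, P), let (σ_t)_{t∈ℕ} be an i.i.d. sequence of edge-valued random variables with P(σ_t = e) > 0 for every edge e of G, and let (U_t)_{t∈ℕ} be an i.i.d. sequence of random vectors uniformly distributed on [0,1)^N, jointly independent of (σ_t). Define q_p(z, u) = ⌊z⌋ + 1 if u < z − ⌊z⌋, and q_p(z, u) = ⌊z⌋ otherwise. Given x(0) ∈ ℝ^N, define x : ℕ → ℝ^N by: if σ_t = {i, j}, then x_{t+1}(i) = (1/2)x_t(i) + (1/2)q_p(x_t(j), U_t(j)) and x_{t+1}(j) = (1/2)x_t(j) + (1/2)q_p(x_t(i), U_t(i)), while x_{t+1}(h) = x_t(h) for h ∉ {i, j}. Then there exists an integer-valued random variable α such that E[α] = (1/N)∑_i x_i(0), and almost surely lim_{t→∞} x_i(t) = α for every i ∈ Fin N. -/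

import Mathlib

open MeasureTheory

/-- The probabilistic quantizer realized via a uniform `[0,1)` variable:
`qp z u = ⌊z⌋ + 1` if `u < Int.fract z`, else `⌊z⌋`. -/
noncomputable def qp (z u : ℝ) : ℤ :=
  if u < Int.fract z then ⌊z⌋ + 1 else ⌊z⌋

/-- The uniform probability distribution on the cube `[0,1)^N`. -/
noncomputable def unifCube (N : ℕ) : Measure (Fin N → ℝ) :=
  Measure.pi fun _ => (volume.restrict (Set.Ico (0:ℝ) 1))

open MeasureTheory ProbabilityTheory Filter Topology

namespace Gossip

/-! ### The quantizer -/

/-- The variance of the probabilistic quantizer at `z`. -/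
noncomputable def quantVar (z : ℝ) : ℝ := Int.fract z * (1 - Int.fract z)

lemma quantVar_nonneg (z : ℝ) : 0 ≤ quantVar z :=
  mul_nonneg (Int.fract_nonneg z) (sub_nonneg.2 (Int.fract_lt_one z).le)

lemma measurable_quantVar : Measurable quantVar := by
  unfold quantVar
  fun_prop

lemma measurable_qp : Measurable fun p : ℝ × ℝ => (qp p.1 p.2 : ℝ) := by
  have h : Measurable fun p : ℝ × ℝ => qp p.1 p.2 := by
    unfold qp
    refine Measurable.ite (measurableSet_lt measurable_snd (by fun_prop)) ?_ ?_
    · exact (measurable_of_countable fun n : ℤ => n + 1).comp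
        (Int.measurable_floor.comp measurable_fst)
    · exact Int.measurable_floor.comp measurable_fst
  exact (measurable_of_countable fun n : ℤ => (n : ℝ)).comp h

lemma abs_qp_sub_le_one (z u : ℝ) : |(qp z u : ℝ) - z| ≤ 1 := by
  have h1 := Int.floor_le z
  have h2 := (Int.lt_floor_add_one z).le
  unfold qp
  split_ifs <;> push_cast <;> rw [abs_le] <;> constructor <;> linarith

/-- A real within distance one of an integer is quantized within distance one of it. -/
lemma abs_qp_sub_intCast_le_one {z : ℝ} {k : ℤ} (hz : |z - k| < 1) (u : ℝ) :
    |(qp z u : ℝ) - k| ≤ 1 := by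
  obtain ⟨h1, h2⟩ := abs_lt.1 hz
  have h3 : k - 1 ≤ ⌊z⌋ := Int.le_floor.2 (by push_cast; linarith)
  have h4 : ⌊z⌋ < k + 1 := Int.floor_lt.2 (by push_cast; linarith)
  have h5 : |qp z u - k| ≤ 1 := by
    unfold qp
    split_ifs <;> rw [abs_le] <;> constructor <;> omega
  exact_mod_cast h5

lemma abs_qp_le {K : ℤ} {z u : ℝ} (hu : 0 ≤ u) (hz : |z| ≤ K) : |(qp z u : ℝ)| ≤ K := by
  obtain ⟨h1, h2⟩ := abs_le.1 hz
  have h3 : -K ≤ ⌊z⌋ := Int.le_floor.2 (by push_cast; linarith)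
  have h4 : ⌊z⌋ ≤ K := by exact_mod_cast (Int.floor_le z).trans h2
  have h5 : |qp z u| ≤ K := by
    unfold qp
    split_ifs with h
    · have h6 : ⌊z⌋ < K := by
        have h7 : (⌊z⌋ : ℝ) < K := by
          have := Int.self_sub_floor z
          linarith
        exact_mod_cast h7
      rw [abs_le]; constructor <;> omega
    · rw [abs_le]; constructor <;> omega
  exact_mod_cast h5

instance isProbabilityMeasure_restrict_Ico :
    IsProbabilityMeasure (volume.restrict (Set.Ico (0 : ℝ) 1)) :=
  ⟨by simp⟩

instance isProbabilityMeasure_unifCube (N : ℕ) : IsProbabilityMeasure (unifCube N) := by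
  unfold unifCube
  infer_instance

lemma integral_comp_qp (F : ℤ → ℝ) (z : ℝ) :
    ∫ v in Set.Ico (0 : ℝ) 1, F (qp z v) =
      (1 - Int.fract z) * F ⌊z⌋ + Int.fract z * F (⌊z⌋ + 1) := by
  have h : ∀ v, F (qp z v) =
      F ⌊z⌋ + (Set.Iio (Int.fract z)).indicator (fun _ => F (⌊z⌋ + 1) - F ⌊z⌋) v := by
    intro v
    unfold qp
    by_cases hv : v < Int.fract z <;> simp [hv]
  have hset : Set.Ico (0 : ℝ) 1 ∩ Set.Iio (Int.fract z) = Set.Ico 0 (Int.fract z) := by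
    ext v
    have := Int.fract_lt_one z
    simp only [Set.mem_inter_iff, Set.mem_Ico, Set.mem_Iio]
    constructor
    · rintro ⟨⟨a, b⟩, c⟩; exact ⟨a, c⟩
    · rintro ⟨a, c⟩; exact ⟨⟨a, c.trans this⟩, c⟩
  simp_rw [h]
  rw [integral_add (integrable_const _) ((integrable_const _).indicator measurableSet_Iio),
    setIntegral_indicator measurableSet_Iio, hset]
  simp [Int.fract_nonneg]
  ring

variable {N : ℕ}

lemma measurable_qp_eval (z : ℝ) (i : Fin N) :
    Measurable fun u : Fin N → ℝ => (qp z (u i) : ℝ) :=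
  measurable_qp.comp (by fun_prop : Measurable fun u : Fin N → ℝ => (z, u i))

lemma integral_unifCube_comp_eval (i : Fin N) {g : ℝ → ℝ} (hg : Measurable g) :
    ∫ u, g (u i) ∂unifCube N = ∫ v in Set.Ico (0 : ℝ) 1, g v := by
  have h := measurePreserving_eval (fun _ : Fin N => volume.restrict (Set.Ico (0 : ℝ) 1)) i
  rw [← h.map_eq, integral_map h.measurable.aemeasurable hg.aestronglyMeasurable]
  rfl

/-- The quantization error is centred. -/
lemma integral_qp_sub (z : ℝ) (i : Fin N) :
    ∫ u, ((qp z (u i) : ℝ) - z) ∂unifCube N = 0 := by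
  have hm : Measurable fun v => (qp z v : ℝ) - z :=
    (measurable_qp.comp (by fun_prop : Measurable fun v : ℝ => (z, v))).sub_const z
  rw [integral_unifCube_comp_eval i hm, integral_comp_qp fun n => (n : ℝ) - z]
  have := Int.self_sub_floor z
  push_cast
  rw [← this]
  ring

lemma integral_qp_sub_sq (z : ℝ) (i : Fin N) :
    ∫ u, ((qp z (u i) : ℝ) - z) ^ 2 ∂unifCube N = quantVar z := by
  have hm : Measurable fun v => ((qp z v : ℝ) - z) ^ 2 :=
    ((measurable_qp.comp (by fun_prop : Measurable fun v : ℝ => (z, v))).sub_const z).pow_const 2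
  rw [integral_unifCube_comp_eval i hm, integral_comp_qp fun n => ((n : ℝ) - z) ^ 2]
  have := Int.self_sub_floor z
  unfold quantVar
  push_cast
  rw [← this]
  ring

/-- Quantization errors at distinct coordinates are uncorrelated. -/
lemma integral_qp_sub_mul (z w : ℝ) {i j : Fin N} (hij : i ≠ j) :
    ∫ u, ((qp z (u i) : ℝ) - z) * ((qp w (u j) : ℝ) - w) ∂unifCube N = 0 := by
  have hind : iIndepFun (fun (i : Fin N) (u : Fin N → ℝ) => u i) (unifCube N) :=
    iIndepFun_pi (X := fun _ v => v) fun _ => measurable_id.aemeasurable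
  have hm : ∀ a : ℝ, Measurable fun v => (qp a v : ℝ) - a := fun a =>
    (measurable_qp.comp (by fun_prop : Measurable fun v : ℝ => (a, v))).sub_const a
  have h := (hind.indepFun hij).comp (hm z) (hm w)
  have := h.integral_fun_mul_eq_mul_integral
    ((hm z).comp (measurable_pi_apply i)).aestronglyMeasurable
    ((hm w).comp (measurable_pi_apply j)).aestronglyMeasurable
  simp only [Function.comp_apply] at this
  rw [this, integral_qp_sub, zero_mul]

/-! ### One step of the algorithm -/

/-- The state after a gossip exchange along the edge `{i, j}` with quantization noise `u`. -/
noncomputable def step (i j : Fin N) (z u : Fin N → ℝ) : Fin N → ℝ := fun h =>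
  if h = i then (1/2) * z i + (1/2) * (qp (z j) (u j) : ℝ)
  else if h = j then (1/2) * z j + (1/2) * (qp (z i) (u i) : ℝ)
  else z h

lemma measurable_step (i j : Fin N) :
    Measurable fun p : (Fin N → ℝ) × (Fin N → ℝ) => step i j p.1 p.2 := by
  have hq : ∀ k : Fin N, Measurable fun p : (Fin N → ℝ) × (Fin N → ℝ) =>
      (qp (p.1 k) (p.2 k) : ℝ) := fun k =>
    measurable_qp.comp
      (by fun_prop : Measurable fun p : (Fin N → ℝ) × (Fin N → ℝ) => (p.1 k, p.2 k))
  have hi := hq i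
  have hj := hq j
  refine measurable_pi_lambda _ fun h => ?_
  unfold step
  split_ifs <;> fun_prop

lemma sum_comp_step (φ : ℝ → ℝ) {i j : Fin N} (hij : i ≠ j) (z u : Fin N → ℝ) :
    ∑ h, φ (step i j z u h) = ∑ h, φ (z h)
      + (φ ((1/2) * z i + (1/2) * (qp (z j) (u j) : ℝ)) - φ (z i))
      + (φ ((1/2) * z j + (1/2) * (qp (z i) (u i) : ℝ)) - φ (z j)) := by
  have h : ∑ h, (φ (step i j z u h) - φ (z h)) = _ :=
    Fintype.sum_eq_add i j hij fun h hh => by simp [step, hh.1, hh.2]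
  rw [Finset.sum_sub_distrib] at h
  have hi : step i j z u i = (1/2) * z i + (1/2) * (qp (z j) (u j) : ℝ) := by simp [step]
  have hj : step i j z u j = (1/2) * z j + (1/2) * (qp (z i) (u i) : ℝ) := by
    simp [step, hij.symm]
  rw [hi, hj] at h
  linarith

/-- The Lyapunov function `∑ zᵢ² - 2 (∑ zᵢ)²`. -/
noncomputable def lyapunov (z : Fin N → ℝ) : ℝ := ∑ h, z h ^ 2 - 2 * (∑ h, z h) ^ 2

/-- The expected decrease of the Lyapunov function under an exchange along `{i, j}`. -/
noncomputable def drift (i j : Fin N) (z : Fin N → ℝ) : ℝ :=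
  (1/2) * (z i - z j) ^ 2 + (1/4) * (quantVar (z i) + quantVar (z j))

lemma drift_nonneg (i j : Fin N) (z : Fin N → ℝ) : 0 ≤ drift i j z := by
  have := quantVar_nonneg (z i)
  have := quantVar_nonneg (z j)
  unfold drift
  positivity

lemma measurable_lyapunov : Measurable (lyapunov : (Fin N → ℝ) → ℝ) := by
  unfold lyapunov
  fun_prop

lemma measurable_drift (i j : Fin N) : Measurable (drift i j) := by
  have := measurable_quantVar
  unfold drift
  fun_prop

lemma integrable_qp_sub (z : ℝ) (i : Fin N) :
    Integrable (fun u => (qp z (u i) : ℝ) - z) (unifCube N) :=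
  .of_bound ((measurable_qp_eval z i).sub_const z).aestronglyMeasurable 1
    (.of_forall fun u => abs_qp_sub_le_one z (u i))

lemma integrable_qp_sub_mul (z w : ℝ) (i j : Fin N) :
    Integrable (fun u => ((qp z (u i) : ℝ) - z) * ((qp w (u j) : ℝ) - w)) (unifCube N) := by
  refine .of_bound (((measurable_qp_eval z i).sub_const z).mul
    ((measurable_qp_eval w j).sub_const w)).aestronglyMeasurable 1 (.of_forall fun u => ?_)
  rw [Real.norm_eq_abs, abs_mul]
  exact mul_le_one₀ (abs_qp_sub_le_one z (u i)) (abs_nonneg _) (abs_qp_sub_le_one w (u j))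

lemma integral_sum_step {i j : Fin N} (hij : i ≠ j) (z : Fin N → ℝ) :
    ∫ u, ∑ h, step i j z u h ∂unifCube N = ∑ h, z h := by
  have h : ∀ u, ∑ h, step i j z u h =
      ∑ h, z h + (1/2) * (((qp (z i) (u i) : ℝ) - z i) + ((qp (z j) (u j) : ℝ) - z j)) := by
    intro u
    rw [sum_comp_step (fun x => x) hij]
    ring
  have hi := integrable_qp_sub (z i) i
  have hj := integrable_qp_sub (z j) j
  simp_rw [h]
  rw [integral_add (integrable_const _) ((hi.fun_add hj).const_mul _), integral_const_mul,
    integral_add hi hj, integral_qp_sub, integral_qp_sub]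
  simp

lemma integral_lyapunov_step {i j : Fin N} (hij : i ≠ j) (z : Fin N → ℝ) :
    ∫ u, lyapunov (step i j z u) ∂unifCube N = lyapunov z - drift i j z := by
  set c : ℝ := (1/2) * (z i + z j) - 2 * ∑ h, z h
  have h : ∀ u, lyapunov (step i j z u) =
      (lyapunov z - (1/2) * (z i - z j) ^ 2)
      + c * (((qp (z i) (u i) : ℝ) - z i) + ((qp (z j) (u j) : ℝ) - z j))
      + (-(1/4) * (((qp (z i) (u i) : ℝ) - z i) ^ 2 + ((qp (z j) (u j) : ℝ) - z j) ^ 2)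
        + (-1) * (((qp (z i) (u i) : ℝ) - z i) * ((qp (z j) (u j) : ℝ) - z j))) := by
    intro u
    unfold lyapunov
    rw [sum_comp_step (fun x => x ^ 2) hij, sum_comp_step (fun x => x) hij]
    ring
  have hi := integrable_qp_sub (z i) i
  have hj := integrable_qp_sub (z j) j
  have hi2 : Integrable (fun u => ((qp (z i) (u i) : ℝ) - z i) ^ 2) (unifCube N) := by
    simpa only [sq] using integrable_qp_sub_mul (z i) (z i) i i
  have hj2 : Integrable (fun u => ((qp (z j) (u j) : ℝ) - z j) ^ 2) (unifCube N) := by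
    simpa only [sq] using integrable_qp_sub_mul (z j) (z j) j j
  have hij2 := integrable_qp_sub_mul (z i) (z j) i j
  simp_rw [h]
  rw [integral_add ((integrable_const _).fun_add ((hi.fun_add hj).const_mul _))
      (((hi2.fun_add hj2).const_mul _).fun_add (hij2.const_mul _)),
    integral_add (integrable_const _) ((hi.fun_add hj).const_mul _),
    integral_add ((hi2.fun_add hj2).const_mul _) (hij2.const_mul _), integral_const_mul,
    integral_const_mul, integral_const_mul,
    integral_add hi hj, integral_add hi2 hj2, integral_qp_sub, integral_qp_sub,
    integral_qp_sub_sq, integral_qp_sub_sq, integral_qp_sub_mul _ _ hij]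
  simp [drift]
  ring

/-! ### Convergence along a single trajectory -/

lemma abs_sub_round_le_two_mul_quantVar (z : ℝ) : |z - round z| ≤ 2 * quantVar z := by
  rw [abs_sub_round_eq_min]
  have h0 := Int.fract_nonneg z
  have h1 := (Int.fract_lt_one z).le
  unfold quantVar
  rcases le_total (Int.fract z) (1/2) with h | h
  · exact (min_le_left _ _).trans (by nlinarith)
  · exact (min_le_right _ _).trans (by nlinarith)

lemma exists_tendsto_of_drift_tendsto_zero (hN : 2 ≤ N) {G : SimpleGraph (Fin N)}
    (hG : G.Connected) (y : ℕ → Fin N → ℝ)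
    (hstep : ∀ t, ∃ i j u, y (t + 1) i = (1/2) * y t i + (1/2) * (qp (y t j) u : ℝ))
    (hdrift : ∀ i j, G.Adj i j → Tendsto (fun t => drift i j (y t)) atTop (𝓝 0)) :
    ∃ k : ℤ, ∀ i, Tendsto (fun t => y t i) atTop (𝓝 (k : ℝ)) := by
  have : Nontrivial (Fin N) := Fin.nontrivial_iff_two_le.2 hN
  let o : Fin N := ⟨0, by omega⟩
  have hdiff : ∀ i j, G.Adj i j → Tendsto (fun t => y t i - y t j) atTop (𝓝 0) := by
    intro i j hij
    have h2 : Tendsto (fun t => (y t i - y t j) ^ 2) atTop (𝓝 0) := by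
      refine squeeze_zero (fun t => sq_nonneg _) (fun t => ?_)
        (by simpa using (hdrift i j hij).const_mul 2)
      have := quantVar_nonneg (y t i)
      have := quantVar_nonneg (y t j)
      unfold drift
      linarith
    have h3 := h2.sqrt
    simp only [Real.sqrt_sq_eq_abs, Real.sqrt_zero] at h3
    exact (tendsto_zero_iff_abs_tendsto_zero _).2 h3
  have hall : ∀ i, Tendsto (fun t => y t i - y t o) atTop (𝓝 0) := by
    intro i
    obtain ⟨w⟩ := hG.preconnected i o
    generalize o = v at w ⊢
    induction w with
    | nil => simp
    | cons hadj _ ih => simpa using (hdiff _ _ hadj).add ih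
  have hround : Tendsto (fun t => y t o - round (y t o)) atTop (𝓝 0) := by
    obtain ⟨j, hj⟩ := hG.preconnected.exists_adj_of_nontrivial o
    refine squeeze_zero_norm (fun t => ?_) (by simpa using (hdrift o j hj).const_mul 8)
    refine (abs_sub_round_le_two_mul_quantVar (y t o)).trans ?_
    have := quantVar_nonneg (y t j)
    have := sq_nonneg (y t o - y t j)
    unfold drift
    linarith
  have hnear : ∀ i, Tendsto (fun t => y t i - round (y t o)) atTop (𝓝 0) := by
    intro i
    simpa using (hall i).add hround
  have hev : ∀ᶠ t in atTop, ∀ i, |y t i - round (y t o)| < 1/4 := by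
    rw [eventually_all]
    intro i
    exact ((tendsto_zero_iff_abs_tendsto_zero _).1 (hnear i)).eventually_lt_const (by norm_num)
  obtain ⟨T, hT⟩ := eventually_atTop.1 hev
  have hconst : ∀ t, T ≤ t → round (y t o) = round (y T o) := by
    intro t ht
    induction t, ht using Nat.le_induction with
    | base => rfl
    | succ t ht ih =>
      rw [← ih]
      obtain ⟨i, j, u, hy⟩ := hstep t
      have hi := abs_lt.1 (hT t ht i)
      have hi' := abs_lt.1 (hT (t + 1) (by omega) i)
      have hq := abs_le.1 (abs_qp_sub_intCast_le_one ((hT t ht j).trans (by norm_num)) u)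
      have h1 : (round (y (t + 1) o) : ℝ) < round (y t o) + 1 := by linarith [hi.1, hi.2]
      have h2 : (round (y t o) : ℝ) < round (y (t + 1) o) + 1 := by linarith [hi.1, hi.2]
      have h1' : round (y (t + 1) o) < round (y t o) + 1 := by exact_mod_cast h1
      have h2' : round (y t o) < round (y (t + 1) o) + 1 := by exact_mod_cast h2
      omega
  refine ⟨round (y T o), fun i => ?_⟩
  have h : Tendsto (fun t => y t i - round (y T o)) atTop (𝓝 0) :=
    (hnear i).congr' (eventually_atTop.2 ⟨T, fun t ht => by rw [hconst t ht]⟩)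
  simpa using h.add_const (round (y T o) : ℝ)

/-! ### The driving noise -/

section Noise

variable {Ω : Type*} {σ : ℕ → Ω → Sym2 (Fin N)} {U : ℕ → Ω → Fin N → ℝ}

/-- The events generating the information revealed at time `t`. -/
def noiseEvents (σ : ℕ → Ω → Sym2 (Fin N)) (U : ℕ → Ω → Fin N → ℝ) (t : ℕ) : Set (Set Ω) :=
  {A | ∃ (e : Sym2 (Fin N)) (B : Set (Fin N → ℝ)), MeasurableSet B ∧
    A = {ω | σ t ω = e} ∩ {ω | U t ω ∈ B}}

/-- The σ-algebra generated by `σ t` and `U t`. -/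
abbrev noiseAlgebra (σ : ℕ → Ω → Sym2 (Fin N)) (U : ℕ → Ω → Fin N → ℝ) (t : ℕ) :
    MeasurableSpace Ω :=
  MeasurableSpace.generateFrom (noiseEvents σ U t)

/-- The information available strictly before time `t`. -/
abbrev past (σ : ℕ → Ω → Sym2 (Fin N)) (U : ℕ → Ω → Fin N → ℝ) (t : ℕ) : MeasurableSpace Ω :=
  ⨆ s ∈ Set.Iio t, noiseAlgebra σ U s

lemma isPiSystem_noiseEvents (t : ℕ) : IsPiSystem (noiseEvents σ U t) := by
  rintro _ ⟨e, B, hB, rfl⟩ _ ⟨e', B', hB', rfl⟩ ⟨ω, ⟨h1, -⟩, ⟨h2, -⟩⟩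
  obtain rfl : e = e' := Eq.trans (Eq.symm h1) h2
  refine ⟨e, B ∩ B', hB.inter hB', ?_⟩
  ext ω
  simp only [Set.mem_inter_iff, Set.mem_ofPred_eq]
  tauto

lemma measurableSet_noiseAlgebra_inter (t : ℕ) (e : Sym2 (Fin N)) {B : Set (Fin N → ℝ)}
    (hB : MeasurableSet B) :
    MeasurableSet[noiseAlgebra σ U t] ({ω | σ t ω = e} ∩ {ω | U t ω ∈ B}) :=
  MeasurableSpace.measurableSet_generateFrom ⟨e, B, hB, rfl⟩

lemma measurableSet_noiseAlgebra_edge (t : ℕ) (e : Sym2 (Fin N)) :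
    MeasurableSet[noiseAlgebra σ U t] {ω | σ t ω = e} := by
  simpa using measurableSet_noiseAlgebra_inter (σ := σ) (U := U) t e MeasurableSet.univ

lemma measurable_noiseAlgebra (t : ℕ) : Measurable[noiseAlgebra σ U t] (U t) := by
  intro B hB
  have h : U t ⁻¹' B = ⋃ e, ({ω | σ t ω = e} ∩ {ω | U t ω ∈ B}) := by
    ext ω
    simp
  rw [h]
  exact MeasurableSet.iUnion fun e => measurableSet_noiseAlgebra_inter t e hB

lemma past_le_past_succ (t : ℕ) : past σ U t ≤ past σ U (t + 1) :=
  biSup_mono fun _ hs => lt_trans hs (Nat.lt_succ_self t)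

lemma noiseAlgebra_le_past_succ (t : ℕ) : noiseAlgebra σ U t ≤ past σ U (t + 1) :=
  le_iSup₂_of_le t (Nat.lt_succ_self t) le_rfl

/-! ### Measurability and boundedness of the state -/

variable {G : SimpleGraph (Fin N)} {x : ℕ → Ω → Fin N → ℝ}

lemma exists_adj_of_mem_edgeSet {e : Sym2 (Fin N)} (he : e ∈ G.edgeSet) :
    ∃ i j, G.Adj i j ∧ e = s(i, j) := by
  induction e with
  | _ i j => exact ⟨i, j, he, rfl⟩

lemma measurable_state_succ {m : MeasurableSpace Ω} {t : ℕ}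
    (hrange : ∀ ω, σ t ω ∈ G.edgeSet)
    (hstep : ∀ ω i j, G.Adj i j → σ t ω = s(i, j) → x (t + 1) ω = step i j (x t ω) (U t ω))
    (hσ : ∀ e, MeasurableSet {ω | σ t ω = e}) (hU : Measurable (U t)) (hx : Measurable (x t)) :
    Measurable (x (t + 1)) := by
  intro A hA
  have h : x (t + 1) ⁻¹' A = ⋃ (i : Fin N) (j : Fin N) (_ : G.Adj i j),
      ({ω | σ t ω = s(i, j)} ∩ (fun ω => step i j (x t ω) (U t ω)) ⁻¹' A) := by
    ext ω
    simp only [Set.mem_preimage, Set.mem_iUnion, Set.mem_inter_iff, Set.mem_ofPred_eq]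
    constructor
    · intro hω
      obtain ⟨i, j, hadj, hij⟩ := exists_adj_of_mem_edgeSet (hrange ω)
      exact ⟨i, j, hadj, hij, by rwa [← hstep ω i j hadj hij]⟩
    · rintro ⟨i, j, hadj, hij, hω⟩
      rwa [hstep ω i j hadj hij]
  rw [h]
  exact MeasurableSet.iUnion fun i => MeasurableSet.iUnion fun j => MeasurableSet.iUnion fun _ =>
    (hσ _).inter (((measurable_step i j).comp (hx.prodMk hU)) hA)

lemma measurable_state_past (hrange : ∀ t ω, σ t ω ∈ G.edgeSet)
    (hstep : ∀ t ω i j, G.Adj i j → σ t ω = s(i, j) → x (t + 1) ω = step i j (x t ω) (U t ω))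
    {x0 : Fin N → ℝ} (h0 : ∀ ω, x 0 ω = x0) (t : ℕ) : Measurable[past σ U t] (x t) := by
  induction t with
  | zero =>
    have : x 0 = fun _ => x0 := funext h0
    rw [this]
    exact @measurable_const _ _ _ (past σ U 0) x0
  | succ t ih =>
    exact measurable_state_succ (m := past σ U (t + 1)) (hrange t) (hstep t)
      (fun e => noiseAlgebra_le_past_succ t _ (measurableSet_noiseAlgebra_edge t e))
      ((measurable_noiseAlgebra t).mono (noiseAlgebra_le_past_succ t) le_rfl)
      (ih.mono (past_le_past_succ t) le_rfl)

lemma abs_state_le {K : ℤ} {ω : Ω} (hrange : ∀ t, σ t ω ∈ G.edgeSet)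
    (hstep : ∀ t i j, G.Adj i j → σ t ω = s(i, j) → x (t + 1) ω = step i j (x t ω) (U t ω))
    (hnonneg : ∀ t i, 0 ≤ U t ω i) (h0 : ∀ i, |x 0 ω i| ≤ K) (t : ℕ) (i : Fin N) :
    |x t ω i| ≤ K := by
  induction t generalizing i with
  | zero => exact h0 i
  | succ t ih =>
    obtain ⟨a, b, hab, he⟩ := exists_adj_of_mem_edgeSet (hrange t)
    have hmid : ∀ c d, |(1/2) * x t ω c + (1/2) * (qp (x t ω d) (U t ω d) : ℝ)| ≤ K := by
      intro c d
      obtain ⟨h1, h2⟩ := abs_le.1 (ih c)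
      obtain ⟨h3, h4⟩ := abs_le.1 (abs_qp_le (hnonneg t d) (ih d))
      rw [abs_le]
      constructor <;> linarith
    rw [hstep t a b hab he]
    unfold step
    split_ifs
    · exact hmid a b
    · exact hmid b a
    · exact ih i

/-! ### Independence -/

variable [mΩ : MeasurableSpace Ω] {P : Measure Ω}

lemma noiseAlgebra_le (hσ : ∀ t e, MeasurableSet {ω | σ t ω = e}) (hU : ∀ t, Measurable (U t))
    (t : ℕ) : noiseAlgebra σ U t ≤ mΩ := by
  refine MeasurableSpace.generateFrom_le ?_
  rintro _ ⟨e, B, hB, rfl⟩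
  exact (hσ t e).inter (hU t hB)

lemma past_le (hσ : ∀ t e, MeasurableSet {ω | σ t ω = e}) (hU : ∀ t, Measurable (U t))
    (t : ℕ) : past σ U t ≤ mΩ :=
  iSup₂_le fun s _ => noiseAlgebra_le hσ hU s

lemma measure_noise_eq
    (hiid : ∀ (s : Finset ℕ) (f : ℕ → Sym2 (Fin N)) (B : ℕ → Set (Fin N → ℝ)),
      (∀ t, MeasurableSet (B t)) →
      P (⋂ t ∈ s, ({ω | σ t ω = f t} ∩ {ω | U t ω ∈ B t})) =
        ∏ t ∈ s, (P {ω | σ 0 ω = f t} * unifCube N (B t)))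
    (t : ℕ) (e : Sym2 (Fin N)) {B : Set (Fin N → ℝ)} (hB : MeasurableSet B) :
    P ({ω | σ t ω = e} ∩ {ω | U t ω ∈ B}) = P {ω | σ 0 ω = e} * unifCube N B := by
  simpa using hiid {t} (fun _ => e) (fun _ => B) fun _ => hB

lemma iIndep_noiseAlgebra [IsProbabilityMeasure P]
    (hσ : ∀ t e, MeasurableSet {ω | σ t ω = e}) (hU : ∀ t, Measurable (U t))
    (hiid : ∀ (s : Finset ℕ) (f : ℕ → Sym2 (Fin N)) (B : ℕ → Set (Fin N → ℝ)),
      (∀ t, MeasurableSet (B t)) →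
      P (⋂ t ∈ s, ({ω | σ t ω = f t} ∩ {ω | U t ω ∈ B t})) =
        ∏ t ∈ s, (P {ω | σ 0 ω = f t} * unifCube N (B t))) :
    iIndep (noiseAlgebra σ U) P := by
  classical
  refine iIndepSets.iIndep (noiseAlgebra_le hσ hU) (noiseEvents σ U) isPiSystem_noiseEvents
    (fun _ => rfl) ((iIndepSets_iff _ _).2 fun s A hA => ?_)
  have : Nonempty Ω := P.nonempty_of_neZero
  have : Nonempty (Sym2 (Fin N)) := this.map (σ 0)
  choose! e B hB hAB using hA
  have hB' : ∀ t, MeasurableSet (if t ∈ s then B t else ∅) := by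
    intro t
    split_ifs with ht
    · exact hB t ht
    · exact MeasurableSet.empty
  have h := hiid s e (fun t => if t ∈ s then B t else ∅) hB'
  calc P (⋂ t ∈ s, A t)
      = P (⋂ t ∈ s, ({ω | σ t ω = e t} ∩ {ω | U t ω ∈ if t ∈ s then B t else ∅})) := by
        congr 1
        refine Set.iInter₂_congr fun t ht => ?_
        rw [hAB t ht, if_pos ht]
    _ = ∏ t ∈ s, P (A t) := by
        rw [h]
        refine Finset.prod_congr rfl fun t ht => ?_
        rw [hAB t ht, if_pos ht, measure_noise_eq hiid t (e t) (hB t ht)]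

lemma indep_past_noiseAlgebra (hσ : ∀ t e, MeasurableSet {ω | σ t ω = e})
    (hU : ∀ t, Measurable (U t)) (hind : iIndep (noiseAlgebra σ U) P) (t : ℕ) :
    Indep (past σ U t) (noiseAlgebra σ U t) P := by
  have h := indep_iSup_of_disjoint (noiseAlgebra_le hσ hU) hind
    (S := Set.Iio t) (T := {t}) (by simp)
  simpa only [iSup_singleton] using h

/-- On the event that the edge `e` is selected, the state and the noise are jointly distributed
as independent copies. -/
lemma map_restrict_state_noise [IsProbabilityMeasure P]
    (hσ : ∀ t e, MeasurableSet {ω | σ t ω = e}) (hU : ∀ t, Measurable (U t))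
    (hiid : ∀ (s : Finset ℕ) (f : ℕ → Sym2 (Fin N)) (B : ℕ → Set (Fin N → ℝ)),
      (∀ t, MeasurableSet (B t)) →
      P (⋂ t ∈ s, ({ω | σ t ω = f t} ∩ {ω | U t ω ∈ B t})) =
        ∏ t ∈ s, (P {ω | σ 0 ω = f t} * unifCube N (B t)))
    {t : ℕ} {y : Ω → Fin N → ℝ} (hy : Measurable[past σ U t] y) (e : Sym2 (Fin N)) :
    (P.restrict {ω | σ t ω = e}).map (fun ω => (y ω, U t ω)) =
      (P {ω | σ 0 ω = e} • P.map y).prod (unifCube N) := by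
  have hy' : Measurable y := hy.mono (past_le hσ hU t) le_rfl
  have hind := (Indep_iff _ _ _).1
    (indep_past_noiseAlgebra hσ hU (iIndep_noiseAlgebra hσ hU hiid) t)
  have : IsFiniteMeasure (P {ω | σ 0 ω = e} • P.map y) :=
    Measure.smul_finite _ (measure_ne_top P _)
  refine (Measure.prod_eq fun A B hA hB => ?_).symm
  have hset : (fun ω => (y ω, U t ω)) ⁻¹' (A ×ˢ B) ∩ {ω | σ t ω = e} =
      y ⁻¹' A ∩ ({ω | σ t ω = e} ∩ {ω | U t ω ∈ B}) := by
    ext ω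
    simp only [Set.mem_inter_iff, Set.mem_preimage, Set.mem_prod, Set.mem_ofPred_eq]
    tauto
  rw [Measure.map_apply (hy'.prodMk (hU t)) (hA.prod hB),
    Measure.restrict_apply ((hy'.prodMk (hU t)) (hA.prod hB)), hset,
    hind _ _ (hy hA) (measurableSet_noiseAlgebra_inter t e hB), measure_noise_eq hiid t e hB,
    Measure.smul_apply, Measure.map_apply hy' hA, smul_eq_mul]
  ring

lemma setIntegral_state_noise [IsProbabilityMeasure P]
    (hσ : ∀ t e, MeasurableSet {ω | σ t ω = e}) (hU : ∀ t, Measurable (U t))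
    (hiid : ∀ (s : Finset ℕ) (f : ℕ → Sym2 (Fin N)) (B : ℕ → Set (Fin N → ℝ)),
      (∀ t, MeasurableSet (B t)) →
      P (⋂ t ∈ s, ({ω | σ t ω = f t} ∩ {ω | U t ω ∈ B t})) =
        ∏ t ∈ s, (P {ω | σ 0 ω = f t} * unifCube N (B t)))
    {t : ℕ} {y : Ω → Fin N → ℝ} (hy : Measurable[past σ U t] y) (e : Sym2 (Fin N))
    {g : (Fin N → ℝ) × (Fin N → ℝ) → ℝ} (hg : Measurable g)
    (hint : IntegrableOn (fun ω => g (y ω, U t ω)) {ω | σ t ω = e} P) :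
    ∫ ω in {ω | σ t ω = e}, g (y ω, U t ω) ∂P =
      P.real {ω | σ 0 ω = e} * ∫ ω, ∫ u, g (y ω, u) ∂unifCube N ∂P := by
  have hy' : Measurable y := hy.mono (past_le hσ hU t) le_rfl
  have hpair : Measurable fun ω => (y ω, U t ω) := hy'.prodMk (hU t)
  have hmap := map_restrict_state_noise hσ hU hiid hy e
  have : IsFiniteMeasure (P {ω | σ 0 ω = e} • P.map y) :=
    Measure.smul_finite _ (measure_ne_top P _)
  have hint' : Integrable g ((P {ω | σ 0 ω = e} • P.map y).prod (unifCube N)) := by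
    rw [← hmap]
    exact (integrable_map_measure hg.aestronglyMeasurable hpair.aemeasurable).2 hint
  rw [← integral_map (f := g) hpair.aemeasurable hg.aestronglyMeasurable, hmap,
    integral_prod _ hint', integral_smul_measure,
    integral_map hy'.aemeasurable
      hg.stronglyMeasurable.integral_prod_right'.aestronglyMeasurable]
  rfl

lemma ae_noise_nonneg (hiid : ∀ (s : Finset ℕ) (f : ℕ → Sym2 (Fin N))
      (B : ℕ → Set (Fin N → ℝ)), (∀ t, MeasurableSet (B t)) →
      P (⋂ t ∈ s, ({ω | σ t ω = f t} ∩ {ω | U t ω ∈ B t})) =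
        ∏ t ∈ s, (P {ω | σ 0 ω = f t} * unifCube N (B t))) :
    ∀ᵐ ω ∂P, ∀ t i, 0 ≤ U t ω i := by
  have hcube : ∀ i, unifCube N {u | u i < 0} = 0 := by
    intro i
    have h := measurePreserving_eval (fun _ : Fin N => volume.restrict (Set.Ico (0 : ℝ) 1)) i
    have h2 := h.measure_preimage (measurableSet_Iio (a := (0 : ℝ))).nullMeasurableSet
    rw [Measure.restrict_apply measurableSet_Iio] at h2
    have h3 : Set.Iio (0 : ℝ) ∩ Set.Ico 0 1 = ∅ := by
      ext v
      simp only [Set.mem_inter_iff, Set.mem_Iio, Set.mem_Ico, Set.mem_empty_iff_false, iff_false]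
      rintro ⟨h, h', -⟩
      linarith
    rw [h3, measure_empty] at h2
    exact h2
  rw [ae_all_iff]
  intro t
  rw [ae_all_iff]
  intro i
  have hB : MeasurableSet {u : Fin N → ℝ | u i < 0} :=
    measurableSet_lt (measurable_pi_apply i) measurable_const
  have hsub : {ω | ¬ 0 ≤ U t ω i} ⊆
      ⋃ e, ({ω | σ t ω = e} ∩ {ω | U t ω ∈ {u : Fin N → ℝ | u i < 0}}) := by
    intro ω hω
    simpa using hω
  refine measure_mono_null hsub (measure_iUnion_null fun e => ?_)
  rw [measure_noise_eq hiid t e hB, hcube, mul_zero]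

lemma integral_eq_sum_setIntegral_edge (hσ : ∀ t e, MeasurableSet {ω | σ t ω = e}) (t : ℕ)
    {f : Ω → ℝ} (hf : Integrable f P) :
    ∫ ω, f ω ∂P = ∑ e, ∫ ω in {ω | σ t ω = e}, f ω ∂P := by
  rw [← integral_iUnion_fintype (hσ t) _ fun e => hf.integrableOn]
  · have : (⋃ e, {ω | σ t ω = e}) = Set.univ := by
      ext ω
      simp
    rw [this, setIntegral_univ]
  · intro e e' hne
    exact Set.disjoint_left.2 fun ω h h' => hne (Eq.trans (Eq.symm h) h')

/-- Conditioning the next state on the selected edge. -/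
lemma setIntegral_comp_state_succ [IsProbabilityMeasure P]
    (hσ : ∀ t e, MeasurableSet {ω | σ t ω = e}) (hU : ∀ t, Measurable (U t))
    (hiid : ∀ (s : Finset ℕ) (f : ℕ → Sym2 (Fin N)) (B : ℕ → Set (Fin N → ℝ)),
      (∀ t, MeasurableSet (B t)) →
      P (⋂ t ∈ s, ({ω | σ t ω = f t} ∩ {ω | U t ω ∈ B t})) =
        ∏ t ∈ s, (P {ω | σ 0 ω = f t} * unifCube N (B t)))
    {t : ℕ} (hx : Measurable[past σ U t] (x t)) {i j : Fin N}
    (hstep : ∀ ω, σ t ω = s(i, j) → x (t + 1) ω = step i j (x t ω) (U t ω))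
    {g : (Fin N → ℝ) → ℝ} (hg : Measurable g) (hint : Integrable (fun ω => g (x (t + 1) ω)) P) :
    ∫ ω in {ω | σ t ω = s(i, j)}, g (x (t + 1) ω) ∂P =
      P.real {ω | σ 0 ω = s(i, j)} * ∫ ω, ∫ u, g (step i j (x t ω) u) ∂unifCube N ∂P := by
  have hcongr : Set.EqOn (fun ω => g (x (t + 1) ω)) (fun ω => g (step i j (x t ω) (U t ω)))
      {ω | σ t ω = s(i, j)} := fun ω hω => congrArg g (hstep ω hω)
  rw [setIntegral_congr_fun (hσ t _) hcongr]
  exact setIntegral_state_noise hσ hU hiid hx s(i, j) (g := fun p => g (step i j p.1 p.2))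
    (hg.comp (measurable_step i j)) (hint.integrableOn.congr_fun hcongr (hσ t _))

end Noise

/-! ### Bounds on a box -/

lemma abs_sum_le_of_abs_le {K : ℝ} {z : Fin N → ℝ} (hz : ∀ i, |z i| ≤ K) :
    |∑ i, z i| ≤ N * K := by
  refine (Finset.abs_sum_le_sum_abs _ _).trans ((Finset.sum_le_sum fun i _ => hz i).trans ?_)
  simp

lemma abs_lyapunov_le_of_abs_le {K : ℝ} {z : Fin N → ℝ} (hz : ∀ i, |z i| ≤ K) :
    |lyapunov z| ≤ N * K ^ 2 + 2 * (N * K) ^ 2 := by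
  have h1 : |∑ i, z i ^ 2| ≤ N * K ^ 2 :=
    abs_sum_le_of_abs_le (z := fun i => z i ^ 2) fun i => by
      rw [abs_pow]
      exact pow_le_pow_left₀ (abs_nonneg _) (hz i) 2
  have h2 : |∑ i, z i| ^ 2 ≤ (N * K) ^ 2 :=
    pow_le_pow_left₀ (abs_nonneg _) (abs_sum_le_of_abs_le hz) 2
  unfold lyapunov
  refine (abs_sub _ _).trans ?_
  rw [abs_mul, abs_two, abs_pow]
  linarith

lemma abs_drift_le_of_abs_le {K : ℝ} {z : Fin N → ℝ} (hz : ∀ i, |z i| ≤ K) (i j : Fin N) :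
    |drift i j z| ≤ (1/2) * (2 * K) ^ 2 + 1/2 := by
  have hq : ∀ w, quantVar w ≤ 1 := fun w =>
    mul_le_one₀ (Int.fract_lt_one w).le (sub_nonneg.2 (Int.fract_lt_one w).le)
      (sub_le_self _ (Int.fract_nonneg w))
  have hd : |z i - z j| ^ 2 ≤ (2 * K) ^ 2 :=
    pow_le_pow_left₀ (abs_nonneg _) ((abs_sub _ _).trans (by linarith [hz i, hz j])) 2
  rw [sq_abs] at hd
  rw [abs_of_nonneg (drift_nonneg i j z)]
  unfold drift
  linarith [hq (z i), hq (z j)]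

/-- Nonnegative functions with summable integrals tend to zero almost everywhere. -/
lemma ae_tendsto_zero_of_sum_integral_le {Ω : Type*} [MeasurableSpace Ω] {P : Measure Ω}
    {f : ℕ → Ω → ℝ} (hf : ∀ t, Measurable (f t)) (h0 : ∀ t ω, 0 ≤ f t ω)
    (hint : ∀ t, Integrable (f t) P) {C : ℝ}
    (hC : ∀ n, ∑ t ∈ Finset.range n, ∫ ω, f t ω ∂P ≤ C) :
    ∀ᵐ ω ∂P, Tendsto (fun t => f t ω) atTop (𝓝 0) := by
  have hm : ∀ t, Measurable fun ω => ENNReal.ofReal (f t ω) := fun t => (hf t).ennreal_ofReal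
  have hsum : Summable fun t => ∫ ω, f t ω ∂P :=
    summable_of_sum_range_le (fun t => integral_nonneg (h0 t)) hC
  have hfin : ∫⁻ ω, ∑' t, ENNReal.ofReal (f t ω) ∂P ≠ ⊤ := by
    rw [lintegral_tsum fun t => (hm t).aemeasurable]
    simp_rw [← ofReal_integral_eq_lintegral_ofReal (hint _) (.of_forall (h0 _))]
    exact hsum.tsum_ofReal_ne_top
  filter_upwards [ae_lt_top (Measurable.tsum hm) hfin] with ω hω
  have h := (ENNReal.tendsto_toReal ENNReal.zero_ne_top).comp
    (ENNReal.tendsto_atTop_zero_of_tsum_ne_top hω.ne)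
  simpa [Function.comp_def, ENNReal.toReal_ofReal (h0 _ ω)] using h

end Gossip

/-- Partially quantized gossip algorithm with probabilistic quantizer:
there is an integer-valued random variable `α` with `E[α]` equal to the initial
average such that almost surely every state converges to `α`. -/
theorem stmt_7 {N : ℕ} (hN : 2 ≤ N) (G : SimpleGraph (Fin N)) (hG : G.Connected)
    {Ω : Type*} [MeasurableSpace Ω] (P : Measure Ω) [IsProbabilityMeasure P]
    (σ : ℕ → Ω → Sym2 (Fin N)) (U : ℕ → Ω → Fin N → ℝ)
    (hrange : ∀ t ω, σ t ω ∈ G.edgeSet)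
    (hmeasσ : ∀ (t : ℕ) (e : Sym2 (Fin N)), MeasurableSet {ω | σ t ω = e})
    (hmeasU : ∀ t : ℕ, Measurable (U t))
    (hiid : ∀ (s : Finset ℕ) (f : ℕ → Sym2 (Fin N)) (B : ℕ → Set (Fin N → ℝ)),
      (∀ t, MeasurableSet (B t)) →
      P (⋂ t ∈ s, ({ω | σ t ω = f t} ∩ {ω | U t ω ∈ B t})) =
        ∏ t ∈ s, (P {ω | σ 0 ω = f t} * unifCube N (B t)))
    (hpos : ∀ e ∈ G.edgeSet, 0 < P {ω | σ 0 ω = e})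
    (x0 : Fin N → ℝ) (x : ℕ → Ω → Fin N → ℝ)
    (h0 : ∀ ω, x 0 ω = x0)
    (hupd : ∀ (t : ℕ) (ω : Ω) (i j : Fin N), G.Adj i j → σ t ω = s(i, j) →
      x (t+1) ω i = (1/2) * x t ω i + (1/2) * ((qp (x t ω j) (U t ω j) : ℤ) : ℝ) ∧
      ∀ h : Fin N, h ≠ i → h ≠ j → x (t+1) ω h = x t ω h) :
    ∃ α : Ω → ℤ, Integrable (fun ω => ((α ω : ℤ) : ℝ)) P ∧
      (∫ ω, ((α ω : ℤ) : ℝ) ∂P) = (N : ℝ)⁻¹ * ∑ i, x0 i ∧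
      ∀ᵐ ω ∂P, ∀ i, Filter.Tendsto (fun t => x t ω i) Filter.atTop
        (nhds ((α ω : ℝ))) := by
  have hstep : ∀ t ω i j, G.Adj i j → σ t ω = s(i, j) →
      x (t + 1) ω = Gossip.step i j (x t ω) (U t ω) := by
    intro t ω i j hij he
    obtain ⟨hi, hne⟩ := hupd t ω i j hij he
    obtain ⟨hj, -⟩ := hupd t ω j i hij.symm (he.trans Sym2.eq_swap)
    funext h
    unfold Gossip.step
    split_ifs with h1 h2
    · rw [h1, hi]
    · rw [h2, hj]
    · exact hne h h1 h2
  have hpast := Gossip.measurable_state_past hrange hstep h0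
  have hxm : ∀ t, Measurable (x t) := fun t =>
    (hpast t).mono (Gossip.past_le hmeasσ hmeasU t) le_rfl
  obtain ⟨K, hK⟩ : ∃ K : ℤ, ∀ i, |x0 i| ≤ K := by
    refine ⟨⌈∑ i, |x0 i|⌉, fun i => le_trans ?_ (Int.le_ceil _)⟩
    exact Finset.single_le_sum (f := fun i => |x0 i|) (fun _ _ => abs_nonneg _)
      (Finset.mem_univ i)
  have hbox : ∀ᵐ ω ∂P, ∀ t i, |x t ω i| ≤ K := by
    filter_upwards [Gossip.ae_noise_nonneg hiid] with ω hω
    exact Gossip.abs_state_le (fun t => hrange t ω) (fun t => hstep t ω) hω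
      fun i => by rw [h0]; exact hK i
  have hbound : ∀ (g : (Fin N → ℝ) → ℝ) (C : ℝ), (∀ z, (∀ i, |z i| ≤ (K : ℝ)) → |g z| ≤ C) →
      ∀ t, ∀ᵐ ω ∂P, ‖g (x t ω)‖ ≤ C := by
    intro g C hg t
    filter_upwards [hbox] with ω hω using hg _ (hω t)
  have hint : ∀ (g : (Fin N → ℝ) → ℝ) (C : ℝ), Measurable g →
      (∀ z, (∀ i, |z i| ≤ (K : ℝ)) → |g z| ≤ C) → ∀ t, Integrable (fun ω => g (x t ω)) P :=
    fun g C hgm hg t =>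
      .of_bound (hgm.comp (hxm t)).aestronglyMeasurable C (hbound g C hg t)
  have hsm : Measurable fun z : Fin N → ℝ => ∑ i, z i := by fun_prop
  have hsint := hint _ _ hsm fun z hz => Gossip.abs_sum_le_of_abs_le hz
  have hlint := hint _ _ Gossip.measurable_lyapunov fun z hz =>
    Gossip.abs_lyapunov_le_of_abs_le hz
  have hdint := fun i j => hint _ _ (Gossip.measurable_drift i j) fun z hz =>
    Gossip.abs_drift_le_of_abs_le hz i j
  have hprob : ∑ e, P.real {ω | σ 0 ω = e} = 1 := by
    have h := Gossip.integral_eq_sum_setIntegral_edge hmeasσ 0 (integrable_const (μ := P) (1 : ℝ))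
    simpa using h.symm
  have hempty : ∀ t e, e ∉ G.edgeSet → {ω | σ t ω = e} = ∅ := by
    intro t e he
    refine Set.eq_empty_of_forall_notMem fun ω hω => he ?_
    rw [← (hω : σ t ω = e)]
    exact hrange t ω
  have hmean : ∀ t, ∫ ω, ∑ i, x t ω i ∂P = ∑ i, x0 i := by
    intro t
    induction t with
    | zero => simp [h0]
    | succ t ih =>
      rw [Gossip.integral_eq_sum_setIntegral_edge hmeasσ t (hsint (t + 1)), ← ih,
        ← one_mul (∫ ω, ∑ i, x t ω i ∂P), ← hprob, Finset.sum_mul]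
      refine Finset.sum_congr rfl fun e _ => ?_
      by_cases he : e ∈ G.edgeSet
      · obtain ⟨i, j, hij, rfl⟩ := Gossip.exists_adj_of_mem_edgeSet he
        rw [Gossip.setIntegral_comp_state_succ hmeasσ hmeasU hiid (hpast t)
          (fun ω => hstep t ω i j hij) hsm (hsint (t + 1))]
        simp_rw [Gossip.integral_sum_step hij.ne]
      · simp [hempty _ e he]
  have hdecr : ∀ i j, G.Adj i j → ∀ t, ∫ ω, Gossip.lyapunov (x (t + 1) ω) ∂P ≤
      ∫ ω, Gossip.lyapunov (x t ω) ∂P -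
        P.real {ω | σ 0 ω = s(i, j)} * ∫ ω, Gossip.drift i j (x t ω) ∂P := by
    intro i j hij t
    have hedge : ∀ a b, G.Adj a b → ∫ ω in {ω | σ t ω = s(a, b)}, Gossip.lyapunov (x (t + 1) ω) ∂P
        = P.real {ω | σ 0 ω = s(a, b)} * ∫ ω, Gossip.lyapunov (x t ω) ∂P -
          P.real {ω | σ 0 ω = s(a, b)} * ∫ ω, Gossip.drift a b (x t ω) ∂P := by
      intro a b hab
      rw [Gossip.setIntegral_comp_state_succ hmeasσ hmeasU hiid (hpast t)
        (fun ω => hstep t ω a b hab) Gossip.measurable_lyapunov (hlint (t + 1))]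
      simp_rw [Gossip.integral_lyapunov_step hab.ne]
      rw [integral_sub (hlint t) (hdint a b t)]
      ring
    have hle : ∀ e, ∫ ω in {ω | σ t ω = e}, Gossip.lyapunov (x (t + 1) ω) ∂P ≤
        P.real {ω | σ 0 ω = e} * ∫ ω, Gossip.lyapunov (x t ω) ∂P -
          if e = s(i, j) then
            P.real {ω | σ 0 ω = s(i, j)} * ∫ ω, Gossip.drift i j (x t ω) ∂P else 0 := by
      intro e
      split_ifs with h
      · rw [h, hedge i j hij]
      · by_cases he : e ∈ G.edgeSet
        · obtain ⟨a, b, hab, rfl⟩ := Gossip.exists_adj_of_mem_edgeSet he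
          rw [hedge a b hab]
          have hd0 : 0 ≤ ∫ ω, Gossip.drift a b (x t ω) ∂P :=
            integral_nonneg fun ω => Gossip.drift_nonneg a b (x t ω)
          gcongr
          positivity
        · simp [hempty _ e he]
    rw [Gossip.integral_eq_sum_setIntegral_edge hmeasσ t (hlint (t + 1))]
    refine (Finset.sum_le_sum fun e _ => hle e).trans (le_of_eq ?_)
    rw [Finset.sum_sub_distrib, ← Finset.sum_mul, hprob]
    simp
  have hdrift : ∀ i j, G.Adj i j →
      ∀ᵐ ω ∂P, Tendsto (fun t => Gossip.drift i j (x t ω)) atTop (𝓝 0) := by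
    intro i j hij
    have hp : 0 < P.real {ω | σ 0 ω = s(i, j)} :=
      ENNReal.toReal_pos (hpos _ hij).ne' (measure_ne_top P _)
    set C : ℝ := N * (K : ℝ) ^ 2 + 2 * (N * (K : ℝ)) ^ 2
    have hlow : ∀ t, |∫ ω, Gossip.lyapunov (x t ω) ∂P| ≤ C := by
      intro t
      have h := norm_integral_le_of_norm_le_const (hbound Gossip.lyapunov C
        (fun z hz => Gossip.abs_lyapunov_le_of_abs_le hz) t)
      simpa using h
    have htel : ∀ n, P.real {ω | σ 0 ω = s(i, j)} *
        ∑ t ∈ Finset.range n, ∫ ω, Gossip.drift i j (x t ω) ∂P ≤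
          ∫ ω, Gossip.lyapunov (x 0 ω) ∂P - ∫ ω, Gossip.lyapunov (x n ω) ∂P := by
      intro n
      induction n with
      | zero => simp
      | succ n ih =>
        rw [Finset.sum_range_succ, mul_add]
        linarith [hdecr i j hij n]
    refine Gossip.ae_tendsto_zero_of_sum_integral_le
      (fun t => (Gossip.measurable_drift i j).comp (hxm t))
      (fun t ω => Gossip.drift_nonneg i j (x t ω)) (hdint i j)
      (C := 2 * C / P.real {ω | σ 0 ω = s(i, j)}) fun n => ?_
    rw [le_div_iff₀' hp]
    linarith [htel n, (abs_le.1 (hlow 0)).2, (abs_le.1 (hlow n)).1]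
  have hconv : ∀ᵐ ω ∂P, ∃ k : ℤ, ∀ i, Tendsto (fun t => x t ω i) atTop (𝓝 (k : ℝ)) := by
    have hall : ∀ᵐ ω ∂P, ∀ i j, G.Adj i j →
        Tendsto (fun t => Gossip.drift i j (x t ω)) atTop (𝓝 0) := by
      simp_rw [ae_all_iff]
      exact hdrift
    filter_upwards [hall] with ω hω
    refine Gossip.exists_tendsto_of_drift_tendsto_zero hN hG (fun t => x t ω) (fun t => ?_) hω
    obtain ⟨i, j, hij, he⟩ := Gossip.exists_adj_of_mem_edgeSet (hrange t ω)
    exact ⟨i, j, U t ω j, (hupd t ω i j hij he).1⟩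
  obtain ⟨α, hα⟩ : ∃ α : Ω → ℤ,
      ∀ᵐ ω ∂P, ∀ i, Tendsto (fun t => x t ω i) atTop (𝓝 (α ω : ℝ)) := by
    classical
    refine ⟨fun ω => if h : ∃ k : ℤ, ∀ i, Tendsto (fun t => x t ω i) atTop (𝓝 (k : ℝ))
      then h.choose else 0, ?_⟩
    filter_upwards [hconv] with ω hω
    rw [dif_pos hω]
    exact hω.choose_spec
  have hN0 : (N : ℝ) ≠ 0 := Nat.cast_ne_zero.2 (by omega)
  have hsum : ∀ᵐ ω ∂P, Tendsto (fun t => ∑ i, x t ω i) atTop (𝓝 (N * (α ω : ℝ))) := by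
    filter_upwards [hα] with ω hω
    simpa using tendsto_finsetSum Finset.univ fun i _ => hω i
  have hαm : AEStronglyMeasurable (fun ω => (α ω : ℝ)) P :=
    aestronglyMeasurable_of_tendsto_ae atTop (f := fun t ω => x t ω ⟨0, by omega⟩)
      (fun t => ((measurable_pi_apply (⟨0, by omega⟩ : Fin N)).comp (hxm t)).aestronglyMeasurable)
      (hα.mono fun ω hω => hω _)
  have hlim := tendsto_integral_of_dominated_convergence (fun _ => N * (K : ℝ))
    (fun t => (hsint t).aestronglyMeasurable) (integrable_const _)
    (hbound _ _ fun z hz => Gossip.abs_sum_le_of_abs_le hz) hsum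
  simp_rw [hmean] at hlim
  refine ⟨α, .of_bound hαm K ?_, ?_, hα⟩
  · filter_upwards [hα, hbox] with ω h1 h2
    exact le_of_tendsto (h1 ⟨0, by omega⟩).norm (.of_forall fun t => h2 t _)
  · have h := tendsto_nhds_unique hlim tendsto_const_nhds
    rw [integral_const_mul] at h
    rw [← h, inv_mul_cancel_left₀ hN0]
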